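/- arXiv:2505.07104 — 5 statements merged into one kernel-verified Lean document; each statement's English description precedes it below -/
import Mathlib

section
/- For all τ ∈ ℝ, the function h(τ) = 3(e^{2τ} − e^{−2τ} + 4τ)/(2(e^τ + e^{−τ})²) satisfies the differential equation h'(τ) − (2 b(τ)/a(τ)) h(τ) − 3 = 0. -/
/-- `a(τ) = 2√2/(e^τ + e^{−τ})`. -/
noncomputable def aa (τ : ℝ) : ℝ := 2 * Real.sqrt 2 / (Real.exp τ + Real.exp (-τ))

/-- `b(τ) = 2√2 (e^{−τ} − e^τ)/(e^τ + e^{−τ})²`. -/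
noncomputable def bb (τ : ℝ) : ℝ :=
  2 * Real.sqrt 2 * (Real.exp (-τ) - Real.exp τ) / (Real.exp τ + Real.exp (-τ)) ^ 2

/-- `h(τ) = 3(e^{2τ} − e^{−2τ} + 4τ)/(2(e^τ + e^{−τ})²)`. -/
noncomputable def hh (τ : ℝ) : ℝ :=
  3 * (Real.exp (2 * τ) - Real.exp (-(2 * τ)) + 4 * τ) / (2 * (Real.exp τ + Real.exp (-τ)) ^ 2)

/-- `h` satisfies `h' − (2b/a) h − 3 = 0`. -/
theorem h_solves_ode (τ : ℝ) :
    HasDerivAt hh (2 * bb τ / aa τ * hh τ + 3) τ := by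
  have hS : Real.exp τ + Real.exp (-τ) ≠ 0 := by positivity
  have hxy : Real.exp τ * Real.exp (-τ) = 1 := by rw [← Real.exp_add]; simp
  have h2 : Real.exp (2 * τ) = Real.exp τ ^ 2 := by rw [← Real.exp_nat_mul]; norm_num
  have h2' : Real.exp (-(2 * τ)) = Real.exp (-τ) ^ 2 := by
    rw [← Real.exp_nat_mul]; congr 1; push_cast; ring
  have hcoeff : 2 * bb τ / aa τ =
      2 * (Real.exp (-τ) - Real.exp τ) / (Real.exp τ + Real.exp (-τ)) := by
    unfold aa bb
    field_simp
  have hlin : HasDerivAt (fun t : ℝ => 2 * t) 2 τ := by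
    simpa using (hasDerivAt_id τ).const_mul 2
  have hN := (((hlin.exp.sub hlin.neg.exp).add ((hasDerivAt_id τ).const_mul 4)).const_mul 3)
  have hD := (((Real.hasDerivAt_exp τ).add (hasDerivAt_neg τ).exp).pow 2).const_mul 2
  refine (hN.div hD (mul_ne_zero two_ne_zero (pow_ne_zero 2 hS))).congr_deriv ?_
  rw [hcoeff]
  simp only [hh, Pi.add_apply, Pi.sub_apply, Pi.neg_apply, Pi.pow_apply, id, h2, h2']
  generalize Real.exp τ = x at *
  generalize Real.exp (-τ) = y at *
  field_simp
  push_cast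
  linear_combination (-4 : ℝ) * (x + y) ^ 2 * hxy
end

section
/- Let x, y : ℝ → ℝ be differentiable functions satisfying the first-variation equations of the unperturbed Duffing equation, x'(τ) = y(τ) and y'(τ) = (1 − 3 a(τ)²) x(τ). Define M(τ) = (b'(τ) x(τ) − b(τ) y(τ))/a(τ) and W(τ) = H̃(τ) x(τ) − H(τ) y(τ). Then for all τ ∈ ℝ, M'(τ) = −(b(τ)/a(τ)) M(τ) and W'(τ) = (b(τ)/a(τ)) W(τ). -/
/-- `b'(τ) = a(τ) − a(τ)³`. -/
noncomputable def bder (τ : ℝ) : ℝ := aa τ - (aa τ) ^ 3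

/-- `H(τ) = (b(τ)h(τ) + a(τ))/a(τ)`. -/
noncomputable def HH (τ : ℝ) : ℝ := (bb τ * hh τ + aa τ) / aa τ

/-- `H̃(τ) = (b'(τ)h(τ) + 2b(τ))/a(τ)`. -/
noncomputable def HT (τ : ℝ) : ℝ := (bder τ * hh τ + 2 * bb τ) / aa τ

theorem aa_pos (τ : ℝ) : 0 < aa τ := by
  unfold aa
  positivity

theorem bb_sq (τ : ℝ) : bb τ ^ 2 = aa τ ^ 2 - aa τ ^ 4 / 2 := by
  have hs : Real.sqrt 2 ^ 2 = 2 := Real.sq_sqrt (by norm_num)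
  have hs4 : Real.sqrt 2 ^ 4 = 4 := by
    rw [show Real.sqrt 2 ^ 4 = (Real.sqrt 2 ^ 2) ^ 2 by ring, hs]
    norm_num
  have he : 0 < Real.exp τ := Real.exp_pos τ
  unfold aa bb
  rw [Real.exp_neg]
  simp only [div_pow, mul_pow, hs, hs4]
  field_simp
  ring

theorem hasDerivAt_exp_neg (τ : ℝ) :
    HasDerivAt (fun s => Real.exp (-s)) (-Real.exp (-τ)) τ := by
  simpa using (hasDerivAt_neg τ).exp

theorem hasDerivAt_aa (τ : ℝ) : HasDerivAt aa (bb τ) τ := by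
  have hS : Real.exp τ + Real.exp (-τ) ≠ 0 := by positivity
  refine ((hasDerivAt_const τ (2 * Real.sqrt 2)).div
    ((Real.hasDerivAt_exp τ).add (hasDerivAt_exp_neg τ)) hS).congr_deriv ?_
  simp only [bb, Pi.add_apply]
  ring

theorem hasDerivAt_bb (τ : ℝ) : HasDerivAt bb (bder τ) τ := by
  have hS : (Real.exp τ + Real.exp (-τ)) ^ 2 ≠ 0 := by positivity
  have hs : Real.sqrt 2 ^ 3 = 2 * Real.sqrt 2 := by
    rw [pow_succ, Real.sq_sqrt (by norm_num)]
  have he : 0 < Real.exp τ := Real.exp_pos τ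
  refine ((((hasDerivAt_exp_neg τ).sub (Real.hasDerivAt_exp τ)).const_mul
    (2 * Real.sqrt 2)).div
    (((Real.hasDerivAt_exp τ).add (hasDerivAt_exp_neg τ)).pow 2) hS).congr_deriv ?_
  simp only [bder, aa, Pi.add_apply, Pi.sub_apply, Pi.pow_apply,
    show 2 - 1 = 1 from rfl, pow_one]
  rw [Real.exp_neg]
  simp only [div_pow, mul_pow, hs]
  field_simp
  ring

theorem hasDerivAt_bder (τ : ℝ) :
    HasDerivAt bder (bb τ * (1 - 3 * aa τ ^ 2)) τ := by
  refine ((hasDerivAt_aa τ).sub ((hasDerivAt_aa τ).pow 3)).congr_deriv ?_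
  norm_num
  ring

theorem hasDerivAt_hh (τ : ℝ) :
    HasDerivAt hh (3 + 2 * (bb τ / aa τ) * hh τ) τ := by
  have hS : 2 * (Real.exp τ + Real.exp (-τ)) ^ 2 ≠ 0 := by positivity
  have hs : Real.sqrt 2 ≠ 0 := by positivity
  have he : 0 < Real.exp τ := Real.exp_pos τ
  have h2 : HasDerivAt (fun s : ℝ => 2 * s) 2 τ := by
    simpa using (hasDerivAt_id τ).const_mul 2
  have h4 : HasDerivAt (fun s : ℝ => 4 * s) 4 τ := by
    simpa using (hasDerivAt_id τ).const_mul 4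
  refine ((((h2.exp.sub h2.fun_neg.exp).add h4).const_mul 3).div
    ((((Real.hasDerivAt_exp τ).add (hasDerivAt_exp_neg τ)).pow 2).const_mul 2)
    hS).congr_deriv ?_
  have he2 : Real.exp (2 * τ) = Real.exp τ ^ 2 := by
    rw [← Real.exp_nat_mul]
    norm_num
  simp only [hh, aa, bb, Pi.add_apply, Pi.sub_apply, Pi.pow_apply,
    show 2 - 1 = 1 from rfl, pow_one]
  rw [Real.exp_neg (2 * τ), Real.exp_neg τ, he2]
  field_simp
  ring

/-- If `x' = y` and `y' = (1 − 3a²)x`, then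
`M = (b'x − by)/a` and `W = H̃x − Hy` satisfy `M' = −(b/a)M` and `W' = (b/a)W`. -/
theorem canonical_coordinates_first_variation
    (x y : ℝ → ℝ)
    (hx : ∀ τ, HasDerivAt x (y τ) τ)
    (hy : ∀ τ, HasDerivAt y ((1 - 3 * (aa τ) ^ 2) * x τ) τ) :
    ∀ τ : ℝ,
      HasDerivAt (fun s => (bder s * x s - bb s * y s) / aa s)
        (-(bb τ / aa τ) * ((bder τ * x τ - bb τ * y τ) / aa τ)) τ ∧
      HasDerivAt (fun s => HT s * x s - HH s * y s)
        ((bb τ / aa τ) * (HT τ * x τ - HH τ * y τ)) τ := by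
  intro τ
  have ha : aa τ ≠ 0 := (aa_pos τ).ne'
  have dC : HasDerivAt (fun s => bder s * x s - bb s * y s) 0 τ := by
    refine (((hasDerivAt_bder τ).mul (hx τ)).sub
      ((hasDerivAt_bb τ).mul (hy τ))).congr_deriv ?_
    ring
  constructor
  · refine (dC.div (hasDerivAt_aa τ) ha).congr_deriv ?_
    field_simp
    ring
  · have dN := (((hasDerivAt_hh τ).mul dC).add
      (((hasDerivAt_bb τ).const_mul 2).mul (hx τ))).sub ((hasDerivAt_aa τ).mul (hy τ))
    have hW : (fun s => HT s * x s - HH s * y s) =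
        fun s => (hh s * (bder s * x s - bb s * y s) + 2 * bb s * x s - aa s * y s) / aa s := by
      funext s
      have hs : aa s ≠ 0 := (aa_pos s).ne'
      simp only [HT, HH]
      field_simp
      ring
    rw [hW]
    refine (dN.div (hasDerivAt_aa τ) ha).congr_deriv ?_
    have hb := bb_sq τ
    simp only [HT, HH, bder, Pi.add_apply, Pi.sub_apply, Pi.mul_apply]
    field_simp
    linear_combination (-4 * x τ) * hb
end

section
/- Let ε > 0, let p ≥ 1 be an odd integer, let r ≥ 0 and q ≥ 1 be integers, and assume p + r ≥ 2. Then ∫_{−∞}^{∞} a(τ)^p b(τ)^r e^{i q ψ_ε(τ)} dτ = (2/3) (2√2)^{p+r} (−1)^{r+q} ∫_{−∞}^{∞} e^{− i q z/(24 ε³)} y(z)^r (y(z) + 2i)^{−(1 + q + (p+2r+1)/2)} (y(z) − 2i)^{−(1 − q + (p+2r+1)/2)} dz, where both exponents are integers (negative integer exponents denoting positive powers in the numerator), and both integrals converge. -/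
open MeasureTheory

/-- `ψ_ε(τ)`. -/
noncomputable def psi (ε τ : ℝ) : ℝ :=
  2 * Real.arctan ((Real.exp τ - Real.exp (-τ)) / 2)
    - (1 / (48 * ε ^ 3)) * (Real.exp (3 * τ) - Real.exp (-(3 * τ)))
    - (3 / (16 * ε ^ 3)) * (Real.exp τ - Real.exp (-τ))

/-- `y(z) = (√(z² + 64) + z)^{1/3} − (√(z² + 64) − z)^{1/3}`. -/
noncomputable def yy (z : ℝ) : ℝ :=
  (Real.sqrt (z ^ 2 + 64) + z) ^ ((1 : ℝ) / 3) - (Real.sqrt (z ^ 2 + 64) - z) ^ ((1 : ℝ) / 3)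

theorem strictMono_cube_add_twelve_mul : StrictMono fun y : ℝ => (y ^ 3 + 12 * y) / 2 := by
  intro x y hxy
  have h : 0 < (y - x) * ((x + y / 2) ^ 2 + 3 / 4 * y ^ 2 + 12) :=
    mul_pos (sub_pos.2 hxy) (by positivity)
  dsimp only
  nlinarith

/-- `yy z` is the real root of `y³ + 12 y = 2 z`. -/
theorem yy_cube_add_twelve_mul (z : ℝ) : (yy z ^ 3 + 12 * yy z) / 2 = z := by
  have hs : Real.sqrt (z ^ 2 + 64) ^ 2 = z ^ 2 + 64 := Real.sq_sqrt (by positivity)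
  have habs : |z| ≤ Real.sqrt (z ^ 2 + 64) := Real.abs_le_sqrt (by linarith)
  have hA : 0 ≤ Real.sqrt (z ^ 2 + 64) + z := by linarith [neg_abs_le z]
  have hB : 0 ≤ Real.sqrt (z ^ 2 + 64) - z := by linarith [le_abs_self z]
  have cube : ∀ x : ℝ, 0 ≤ x → (x ^ ((1 : ℝ) / 3)) ^ 3 = x := fun x hx => by
    rw [← Real.rpow_natCast, ← Real.rpow_mul hx]
    norm_num
  have hAB : (Real.sqrt (z ^ 2 + 64) + z) ^ ((1 : ℝ) / 3) *
      (Real.sqrt (z ^ 2 + 64) - z) ^ ((1 : ℝ) / 3) = 4 := by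
    rw [← Real.mul_rpow hA hB,
      show (Real.sqrt (z ^ 2 + 64) + z) * (Real.sqrt (z ^ 2 + 64) - z) = (4 : ℝ) ^ (3 : ℝ) by
        norm_num; linear_combination hs,
      ← Real.rpow_mul (by norm_num)]
    norm_num
  have h1 := cube _ hA
  have h2 := cube _ hB
  unfold yy
  set A := (Real.sqrt (z ^ 2 + 64) + z) ^ ((1 : ℝ) / 3)
  set B := (Real.sqrt (z ^ 2 + 64) - z) ^ ((1 : ℝ) / 3)
  linear_combination (1 / 2) * h1 - (1 / 2) * h2 - (3 / 2) * (A - B) * hAB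

theorem yy_four_sinh_cube (τ : ℝ) :
    yy (4 * Real.sinh τ ^ 3 + 12 * Real.sinh τ) = 2 * Real.sinh τ := by
  apply strictMono_cube_add_twelve_mul.injective
  dsimp only
  rw [yy_cube_add_twelve_mul]
  ring

theorem injective_four_sinh_cube :
    Function.Injective fun τ : ℝ => 4 * Real.sinh τ ^ 3 + 12 * Real.sinh τ := by
  intro x y hxy
  have h := congrArg yy hxy
  simp only [yy_four_sinh_cube] at h
  exact Real.sinh_injective (by linarith)

theorem surjective_four_sinh_cube :
    Function.Surjective fun τ : ℝ => 4 * Real.sinh τ ^ 3 + 12 * Real.sinh τ := by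
  intro z
  refine ⟨Real.arsinh (yy z / 2), ?_⟩
  dsimp only
  rw [Real.sinh_arsinh]
  linear_combination yy_cube_add_twelve_mul z

theorem hasDerivAt_four_sinh_cube (τ : ℝ) :
    HasDerivAt (fun τ : ℝ => 4 * Real.sinh τ ^ 3 + 12 * Real.sinh τ)
      (12 * Real.cosh τ ^ 3) τ := by
  have h := (((Real.hasDerivAt_sinh τ).pow 3).const_mul 4).add
    ((Real.hasDerivAt_sinh τ).const_mul 12)
  refine h.congr_deriv ?_
  norm_num
  linear_combination (-12 * Real.cosh τ) * Real.cosh_sq τ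

theorem aa_eq (τ : ℝ) : aa τ = 2 * Real.sqrt 2 / (2 * Real.cosh τ) := by
  rw [aa, Real.cosh_eq]
  ring

theorem bb_eq (τ : ℝ) :
    bb τ = -(2 * Real.sqrt 2 * (2 * Real.sinh τ)) / (2 * Real.cosh τ) ^ 2 := by
  rw [bb, Real.cosh_eq, Real.sinh_eq]
  ring

theorem psi_eq (ε τ : ℝ) :
    psi ε τ = 2 * Real.arctan (Real.sinh τ)
      - (4 * Real.sinh τ ^ 3 + 12 * Real.sinh τ) / (24 * ε ^ 3) := by
  have h3 := Real.sinh_three_mul τ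
  rw [Real.sinh_eq (3 * τ)] at h3
  have h1 := Real.sinh_eq τ
  rw [psi, ← h1]
  linear_combination (-(1 / (24 * ε ^ 3))) * h3 + (3 / (8 * ε ^ 3)) * h1

theorem cexp_two_arctan_sinh (τ : ℝ) :
    Complex.exp (Complex.I * (2 * Real.arctan (Real.sinh τ) : ℝ)) =
      -((2 * Real.sinh τ : ℝ) - 2 * Complex.I) / ((2 * Real.sinh τ : ℝ) + 2 * Complex.I) := by
  have hc : (Real.cosh τ : ℂ) ≠ 0 := by exact_mod_cast (Real.cosh_pos τ).ne'
  have hcs : (Real.cosh τ : ℂ) ^ 2 = (Real.sinh τ : ℂ) ^ 2 + 1 := by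
    exact_mod_cast Real.cosh_sq τ
  have hu : ((2 * Real.sinh τ : ℝ) : ℂ) + 2 * Complex.I ≠ 0 := fun h => by
    simpa using congrArg Complex.im h
  have hsq : Real.sqrt (1 + Real.sinh τ ^ 2) = Real.cosh τ := by
    rw [add_comm, ← Real.cosh_sq, Real.sqrt_sq (Real.cosh_pos τ).le]
  have he : Complex.exp (Complex.I * (2 * Real.arctan (Real.sinh τ) : ℝ)) =
      ((1 + Real.sinh τ * Complex.I) / Real.cosh τ) ^ 2 := by
    rw [show Complex.I * ((2 * Real.arctan (Real.sinh τ) : ℝ) : ℂ) =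
        ((2 : ℕ) : ℂ) * ((Real.arctan (Real.sinh τ) : ℝ) * Complex.I) by push_cast; ring,
      Complex.exp_nat_mul, Complex.exp_mul_I, ← Complex.ofReal_cos, ← Complex.ofReal_sin,
      Real.cos_arctan, Real.sin_arctan, hsq]
    push_cast
    ring
  rw [he, div_pow, hcs, eq_div_iff hu, div_mul_eq_mul_div, div_eq_iff (hcs ▸ pow_ne_zero 2 hc)]
  simp only [Complex.ofReal_mul, Complex.ofReal_ofNat]
  linear_combination (4 * (Real.sinh τ : ℂ) + 2 * (Real.sinh τ : ℂ) ^ 3 +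
    2 * (Real.sinh τ : ℂ) ^ 2 * Complex.I) * Complex.I_sq

theorem integrable_iff_integrable_abs_deriv_smul {f f' : ℝ → ℝ}
    (hf' : ∀ x, HasDerivAt f (f' x) x) (hf : Function.Bijective f)
    {F : Type*} [NormedAddCommGroup F] [NormedSpace ℝ F] (g : ℝ → F) :
    Integrable g ↔ Integrable fun x => |f' x| • g (f x) := by
  have h := integrableOn_image_iff_integrableOn_abs_deriv_smul MeasurableSet.univ
    (fun x _ => (hf' x).hasDerivWithinAt) hf.injective.injOn g
  rwa [Set.image_univ, hf.surjective.range_eq, integrableOn_univ, integrableOn_univ] at h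

theorem integral_eq_integral_abs_deriv_smul {f f' : ℝ → ℝ}
    (hf' : ∀ x, HasDerivAt f (f' x) x) (hf : Function.Bijective f)
    {F : Type*} [NormedAddCommGroup F] [NormedSpace ℝ F] (g : ℝ → F) :
    ∫ x, g x = ∫ x, |f' x| • g (f x) := by
  have h := integral_image_eq_integral_abs_deriv_smul MeasurableSet.univ
    (fun x _ => (hf' x).hasDerivWithinAt) hf.injective.injOn g
  rwa [Set.image_univ, hf.surjective.range_eq, setIntegral_univ, setIntegral_univ] at h

theorem integrable_inv_cosh : Integrable fun τ : ℝ => (Real.cosh τ)⁻¹ := by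
  refine ((integrable_iff_integrable_abs_deriv_smul Real.hasDerivAt_sinh Real.sinh_bijective
    _).1 integrable_inv_one_add_sq).congr (Filter.Eventually.of_forall fun τ => ?_)
  have hc := Real.cosh_pos τ
  simp only [smul_eq_mul]
  rw [abs_of_pos hc, add_comm, ← Real.cosh_sq]
  field_simp

theorem abs_aa_pow_mul_bb_pow_le {p : ℕ} (hp : 1 ≤ p) (r : ℕ) (τ : ℝ) :
    |aa τ ^ p * bb τ ^ r| ≤ (2 * Real.sqrt 2) ^ (p + r) * (Real.cosh τ)⁻¹ := by
  obtain ⟨k, rfl⟩ := Nat.exists_eq_add_of_le' hp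
  have hc := Real.cosh_pos τ
  have h1 := Real.one_le_cosh τ
  have hS : |Real.sinh τ| ≤ Real.cosh τ := by
    refine abs_le_of_sq_le_sq ?_ hc.le
    linarith [Real.cosh_sq τ]
  have hinv : (Real.cosh τ)⁻¹ ≤ 1 := inv_le_one_of_one_le₀ h1
  have ha' : |aa τ| ≤ 2 * Real.sqrt 2 * (Real.cosh τ)⁻¹ := by
    rw [aa_eq, abs_of_nonneg (by positivity), ← div_eq_mul_inv]
    gcongr
    linarith
  have ha : |aa τ| ≤ 2 * Real.sqrt 2 :=
    ha'.trans (mul_le_of_le_one_right (by positivity) hinv)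
  have hb : |bb τ| ≤ 2 * Real.sqrt 2 := by
    rw [bb_eq, neg_div, abs_neg, abs_div, abs_mul (2 * Real.sqrt 2),
      abs_of_nonneg (by positivity : 0 ≤ 2 * Real.sqrt 2), abs_mul,
      abs_of_nonneg (by positivity : 0 ≤ (2 * Real.cosh τ) ^ 2), abs_two,
      div_le_iff₀ (by positivity)]
    gcongr
    nlinarith
  calc |aa τ ^ (k + 1) * bb τ ^ r| = |aa τ| ^ k * |aa τ| * |bb τ| ^ r := by
        rw [abs_mul, abs_pow, abs_pow, pow_succ]
    _ ≤ (2 * Real.sqrt 2) ^ k * (2 * Real.sqrt 2 * (Real.cosh τ)⁻¹) * (2 * Real.sqrt 2) ^ r := by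
        gcongr
    _ = _ := by ring

theorem integrable_aa_pow_mul_bb_pow_mul_cexp {p : ℕ} (hp : 1 ≤ p) (q r : ℕ) (ε : ℝ) :
    Integrable fun τ : ℝ =>
      (((aa τ) ^ p * (bb τ) ^ r : ℝ) : ℂ) *
        Complex.exp (Complex.I * (q : ℂ) * (psi ε τ : ℂ)) := by
  refine (integrable_inv_cosh.const_mul ((2 * Real.sqrt 2) ^ (p + r))).mono' ?_
    (Filter.Eventually.of_forall fun τ => ?_)
  · refine Continuous.aestronglyMeasurable ?_
    have ha : Continuous aa := by
      refine Continuous.div (by fun_prop) (by fun_prop) fun τ => by positivity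
    have hb : Continuous bb := by
      refine Continuous.div (by fun_prop) (by fun_prop) fun τ => by positivity
    have hpsi : Continuous (psi ε) := by
      unfold psi
      fun_prop
    fun_prop
  · have h : Complex.I * (q : ℂ) * (psi ε τ : ℂ) = ((q * psi ε τ : ℝ) : ℂ) * Complex.I := by
      push_cast
      ring
    rw [h, norm_mul, Complex.norm_exp_ofReal_mul_I, mul_one, Complex.norm_real, Real.norm_eq_abs]
    exact abs_aa_pow_mul_bb_pow_le hp r τ

theorem cexp_psi (ε τ : ℝ) (q : ℕ) :
    Complex.exp (Complex.I * (q : ℂ) * (psi ε τ : ℂ)) =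
      Complex.exp (-(Complex.I * (q : ℂ) * ((4 * Real.sinh τ ^ 3 + 12 * Real.sinh τ : ℝ) : ℂ)) /
          (24 * (ε : ℂ) ^ 3)) *
        (-((2 * Real.sinh τ : ℝ) - 2 * Complex.I) /
          ((2 * Real.sinh τ : ℝ) + 2 * Complex.I)) ^ q := by
  rw [← cexp_two_arctan_sinh, ← Complex.exp_nat_mul, ← Complex.exp_add, psi_eq]
  congr 1
  push_cast
  ring

/-- With `u v = w²`, the weight `w³` turns the two integer powers into `w^{-(2k+1+2r)} (v/u)^q`. -/
theorem zpow_mul_zpow_mul_cube {u v w : ℂ} (hu : u ≠ 0) (hv : v ≠ 0) (hw : w ≠ 0)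
    (huv : u * v = w ^ 2) (q k r : ℕ) :
    w ^ 3 * (u ^ (-(1 + (q : ℤ) + ((k : ℤ) + r + 1))) * v ^ (-(1 - (q : ℤ) + ((k : ℤ) + r + 1)))) =
      (v / u) ^ q / w ^ (2 * k + 1 + 2 * r) := by
  have h1 : u ^ (-(1 + (q : ℤ) + ((k : ℤ) + r + 1))) = (u ^ (k + r + 2))⁻¹ * (u ^ q)⁻¹ := by
    rw [← mul_inv, ← pow_add, ← zpow_natCast, ← zpow_neg]
    congr 1
    push_cast
    ring
  have h2 : v ^ (-(1 - (q : ℤ) + ((k : ℤ) + r + 1))) = (v ^ (k + r + 2))⁻¹ * v ^ q := by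
    rw [← zpow_natCast, ← zpow_natCast, ← zpow_neg, ← zpow_add₀ hv]
    congr 1
    push_cast
    ring
  have h3 : (u ^ (k + r + 2))⁻¹ * (v ^ (k + r + 2))⁻¹ = (w ^ (2 * (k + r + 2)))⁻¹ := by
    rw [← mul_inv, ← mul_pow, huv, ← pow_mul]
  calc _ = w ^ 3 * ((u ^ (k + r + 2))⁻¹ * (v ^ (k + r + 2))⁻¹) * (v / u) ^ q := by
        rw [h1, h2, div_pow]
        ring
    _ = _ := by
        rw [h3, show 2 * (k + r + 2) = 3 + (2 * k + 1 + 2 * r) by ring, pow_add]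
        field_simp

theorem integrand_eq (ε : ℝ) {p : ℕ} (hodd : Odd p) (q r : ℕ) (τ : ℝ) :
    (((aa τ) ^ p * (bb τ) ^ r : ℝ) : ℂ) * Complex.exp (Complex.I * (q : ℂ) * (psi ε τ : ℂ)) =
      (2 / 3 : ℂ) * ((2 * Real.sqrt 2 : ℝ) : ℂ) ^ (p + r) * (-1 : ℂ) ^ (r + q) *
        (|12 * Real.cosh τ ^ 3| •
          (Complex.exp (-(Complex.I * (q : ℂ) *
              ((4 * Real.sinh τ ^ 3 + 12 * Real.sinh τ : ℝ) : ℂ)) / (24 * (ε : ℂ) ^ 3)) *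
            ((yy (4 * Real.sinh τ ^ 3 + 12 * Real.sinh τ) : ℂ)) ^ r *
            ((yy (4 * Real.sinh τ ^ 3 + 12 * Real.sinh τ) : ℂ) + 2 * Complex.I) ^
              (-(1 + (q : ℤ) + ((p : ℤ) + 2 * (r : ℤ) + 1) / 2)) *
            ((yy (4 * Real.sinh τ ^ 3 + 12 * Real.sinh τ) : ℂ) - 2 * Complex.I) ^
              (-(1 - (q : ℤ) + ((p : ℤ) + 2 * (r : ℤ) + 1) / 2)))) := by
  obtain ⟨k, rfl⟩ := hodd
  have hm : (((2 * k + 1 : ℕ) : ℤ) + 2 * (r : ℤ) + 1) / 2 = (k : ℤ) + r + 1 := by omega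
  have hc := Real.cosh_pos τ
  have hw : ((2 * Real.cosh τ : ℝ) : ℂ) ≠ 0 := by
    exact_mod_cast (by positivity : (2 * Real.cosh τ : ℝ) ≠ 0)
  have hu : ((2 * Real.sinh τ : ℝ) : ℂ) + 2 * Complex.I ≠ 0 := fun h => by
    simpa using congrArg Complex.im h
  have hv : ((2 * Real.sinh τ : ℝ) : ℂ) - 2 * Complex.I ≠ 0 := fun h => by
    simpa using congrArg Complex.im h
  have huv : (((2 * Real.sinh τ : ℝ) : ℂ) + 2 * Complex.I) *
      (((2 * Real.sinh τ : ℝ) : ℂ) - 2 * Complex.I) = ((2 * Real.cosh τ : ℝ) : ℂ) ^ 2 := by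
    have h : ((2 * Real.cosh τ : ℝ) : ℂ) ^ 2 = ((2 * Real.sinh τ : ℝ) : ℂ) ^ 2 + 4 := by
      have h' : (2 * Real.cosh τ) ^ 2 = (2 * Real.sinh τ) ^ 2 + 4 := by
        linear_combination 4 * Real.cosh_sq τ
      exact_mod_cast h'
    rw [h]
    linear_combination (-4) * Complex.I_sq
  have key := zpow_mul_zpow_mul_cube hu hv hw huv q k r
  rw [yy_four_sinh_cube, hm, cexp_psi, aa_eq, bb_eq, abs_of_pos (by positivity),
    show 12 * Real.cosh τ ^ 3 = 3 / 2 * (2 * Real.cosh τ) ^ 3 by ring, Complex.real_smul]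
  generalize 2 * Real.sinh τ = y at *
  generalize 2 * Real.cosh τ = w at *
  generalize 2 * Real.sqrt 2 = c at *
  generalize Complex.exp _ = E at *
  calc _ = (c : ℂ) ^ (2 * k + 1 + r) * (-1) ^ (r + q) * E * (y : ℂ) ^ r *
        (((y : ℂ) - 2 * Complex.I) / (y + 2 * Complex.I)) ^ q / (w : ℂ) ^ (2 * k + 1 + 2 * r) := by
        rw [neg_div ((y : ℂ) + 2 * Complex.I), neg_pow (_ / ((y : ℂ) + 2 * Complex.I)) q]
        push_cast
        rw [neg_div, neg_pow (_ / _) r, div_pow, div_pow, ← pow_mul, mul_pow,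
          pow_add (-1 : ℂ)]
        field_simp
        ring
    _ = _ := by
        rw [mul_div_assoc, ← key]
        push_cast
        ring

/-- Change of variables formula:
`∫ a^p b^r e^{iqψ_ε} dτ = (2/3)(2√2)^{p+r}(−1)^{r+q}
∫ e^{−iqz/(24ε³)} y(z)^r (y(z)+2i)^{−(1+q+(p+2r+1)/2)} (y(z)−2i)^{−(1−q+(p+2r+1)/2)} dz`,
and both integrals converge. -/
theorem change_of_variables_integral
    (ε : ℝ) (hε : 0 < ε) (p q r : ℕ)
    (hodd : Odd p) (hp : 1 ≤ p) (hq : 1 ≤ q) (hpr : 2 ≤ p + r) :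
    Integrable (fun τ : ℝ =>
      (((aa τ) ^ p * (bb τ) ^ r : ℝ) : ℂ) * Complex.exp (Complex.I * (q : ℂ) * (psi ε τ : ℂ))) ∧
    Integrable (fun z : ℝ =>
      Complex.exp (-(Complex.I * (q : ℂ) * (z : ℂ)) / (24 * (ε : ℂ) ^ 3)) * ((yy z : ℂ)) ^ r *
        ((yy z : ℂ) + 2 * Complex.I) ^ (-(1 + (q : ℤ) + ((p : ℤ) + 2 * (r : ℤ) + 1) / 2)) *
        ((yy z : ℂ) - 2 * Complex.I) ^ (-(1 - (q : ℤ) + ((p : ℤ) + 2 * (r : ℤ) + 1) / 2))) ∧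
    (∫ τ : ℝ,
        (((aa τ) ^ p * (bb τ) ^ r : ℝ) : ℂ) * Complex.exp (Complex.I * (q : ℂ) * (psi ε τ : ℂ)))
      = (2 / 3 : ℂ) * ((2 * Real.sqrt 2 : ℝ) : ℂ) ^ (p + r) * (-1 : ℂ) ^ (r + q) *
        ∫ z : ℝ,
          Complex.exp (-(Complex.I * (q : ℂ) * (z : ℂ)) / (24 * (ε : ℂ) ^ 3)) * ((yy z : ℂ)) ^ r *
            ((yy z : ℂ) + 2 * Complex.I) ^ (-(1 + (q : ℤ) + ((p : ℤ) + 2 * (r : ℤ) + 1) / 2)) *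
            ((yy z : ℂ) - 2 * Complex.I) ^ (-(1 - (q : ℤ) + ((p : ℤ) + 2 * (r : ℤ) + 1) / 2)) := by
  have hG := integrable_aa_pow_mul_bb_pow_mul_cexp hp q r ε
  have hbij : Function.Bijective fun τ : ℝ => 4 * Real.sinh τ ^ 3 + 12 * Real.sinh τ :=
    ⟨injective_four_sinh_cube, surjective_four_sinh_cube⟩
  have hK : (2 / 3 : ℂ) * ((2 * Real.sqrt 2 : ℝ) : ℂ) ^ (p + r) * (-1 : ℂ) ^ (r + q) ≠ 0 := by
    have h2 : ((2 * Real.sqrt 2 : ℝ) : ℂ) ≠ 0 := by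
      exact_mod_cast (by positivity : (2 * Real.sqrt 2 : ℝ) ≠ 0)
    exact mul_ne_zero (mul_ne_zero (by norm_num) (pow_ne_zero _ h2))
      (pow_ne_zero _ (by norm_num))
  have key := integrand_eq ε hodd q r
  refine ⟨hG, ?_, ?_⟩
  · rw [integrable_iff_integrable_abs_deriv_smul hasDerivAt_four_sinh_cube hbij,
      ← integrable_const_mul_iff (IsUnit.mk0 _ hK)]
    exact hG.congr (Filter.Eventually.of_forall key)
  · refine (integral_congr_ae (Filter.Eventually.of_forall key)).trans ?_
    rw [integral_const_mul]
    congr 1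
    symm
    exact integral_eq_integral_abs_deriv_smul hasDerivAt_four_sinh_cube hbij _
end

section
/- There exist constants C > 0 and ε₁ > 0 such that for all ε ∈ (0, ε₁), |∫_{−∞}^{∞} e^{−(i/ε³)(z³/3 + z)} (z + i)^{−4} dz − (4√π/3) ε^{−9/2} e^{−2/(3ε³)}| ≤ C ε^{−3} e^{−2/(3ε³)}. -/
open MeasureTheory

open Filter Topology Set

/-- Horizontal contour shift for a function holomorphic on a closed strip that decays uniformly
at both ends of the strip. -/
theorem integral_add_mul_I_eq_of_tendsto_zero {f : ℂ → ℂ} {c d : ℝ} {B : ℝ → ℝ} (hcd : c ≤ d)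
    (hf : ∀ s : ℂ, c ≤ s.im → s.im ≤ d → DifferentiableAt ℂ f s)
    (hB : ∀ x y : ℝ, c ≤ y → y ≤ d → ‖f (x + y * Complex.I)‖ ≤ B |x|)
    (hB_lim : Tendsto B atTop (𝓝 0))
    (hc : Integrable fun x : ℝ => f (x + c * Complex.I))
    (hd : Integrable fun x : ℝ => f (x + d * Complex.I)) :
    ∫ x : ℝ, f (x + c * Complex.I) = ∫ x : ℝ, f (x + d * Complex.I) := by
  have hside : ∀ σ : ℝ, |σ| = 1 →
      Tendsto (fun T : ℝ => ∫ y in c..d, f ((σ * T : ℝ) + y * Complex.I)) atTop (𝓝 0) := by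
    intro σ hσ
    have hlim : Tendsto (fun T => B T * |d - c|) atTop (𝓝 0) := by
      simpa using hB_lim.mul_const |d - c|
    refine squeeze_zero_norm' ?_ hlim
    filter_upwards [eventually_ge_atTop 0] with T hT
    refine intervalIntegral.norm_integral_le_of_norm_le_const fun y hy => ?_
    rw [uIoc_of_le hcd] at hy
    have h := hB (σ * T) y hy.1.le hy.2
    rwa [abs_mul, hσ, one_mul, abs_of_nonneg hT] at h
  have hrect : ∀ T : ℝ, (∫ x in (-T)..T, f (x + c * Complex.I)) -
      (∫ x in (-T)..T, f (x + d * Complex.I)) +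
      Complex.I • (∫ y in c..d, f (((1 : ℝ) * T : ℝ) + y * Complex.I)) -
      Complex.I • (∫ y in c..d, f (((-1 : ℝ) * T : ℝ) + y * Complex.I)) = 0 := by
    intro T
    have h := Complex.integral_boundary_rect_eq_zero_of_differentiableOn f
      ((-T : ℝ) + c * Complex.I) ((T : ℝ) + d * Complex.I) ?_
    · simpa using h
    · intro s hs
      have him := hs.2
      simp only [mem_preimage, Complex.add_im, Complex.ofReal_im, Complex.mul_im,
        Complex.ofReal_re, Complex.I_im, Complex.I_re, mul_one, mul_zero, zero_add, add_zero,
        uIcc_of_le hcd] at him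
      exact (hf s him.1 him.2).differentiableWithinAt
  have hlim := (((intervalIntegral_tendsto_integral hc tendsto_neg_atTop_atBot tendsto_id).sub
    (intervalIntegral_tendsto_integral hd tendsto_neg_atTop_atBot tendsto_id)).add
    ((hside 1 (by simp)).const_smul Complex.I)).sub
    ((hside (-1) (by simp)).const_smul Complex.I)
  have hzero := tendsto_nhds_unique hlim
    (tendsto_const_nhds.congr fun T => (hrect T).symm)
  rw [smul_zero, add_zero, sub_zero] at hzero
  exact sub_eq_zero.mp hzero

theorem norm_cexp_sub_one_le_of_re_le {u : ℂ} {M : ℝ} (hM : 0 ≤ M) (hu : u.re ≤ M) :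
    ‖Complex.exp u - 1‖ ≤ Real.exp M * ‖u‖ := by
  have h := (convex_halfSpace_re_le M).norm_image_sub_le_of_norm_deriv_le (f := Complex.exp)
    (C := Real.exp M) (x := 0) (y := u) (fun _ _ => Complex.differentiableAt_exp)
    (fun z hz => by
      rw [Complex.deriv_exp, Complex.norm_exp]
      exact Real.exp_le_exp.mpr hz) (by simpa using hM) hu
  simpa using h

theorem one_add_sq_le_norm_pow_four {x y : ℝ} (hy : 1 ≤ y) :
    1 + x ^ 2 ≤ ‖(x + y * Complex.I : ℂ)‖ ^ 4 := by
  have h : ‖(x + y * Complex.I : ℂ)‖ ^ 2 = x ^ 2 + y ^ 2 := by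
    rw [← Complex.normSq_eq_norm_sq, Complex.normSq_add_mul_I]
  rw [show ‖(x + y * Complex.I : ℂ)‖ ^ 4 = (‖(x + y * Complex.I : ℂ)‖ ^ 2) ^ 2 by ring, h]
  nlinarith [sq_nonneg x, sq_nonneg (x ^ 2 + y ^ 2 - 1)]

theorem add_mul_I_ne_zero {x y : ℝ} (hy : 1 ≤ y) : (x + y * Complex.I : ℂ) ≠ 0 := by
  intro h
  have := congrArg Complex.im h
  simp at this
  linarith

/-- The rescaled integrand, centred at the saddle point. -/
noncomputable def saddleIntegrand (a : ℝ) (s : ℂ) : ℂ :=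
  Complex.exp (-s ^ 2 - Complex.I * a * s ^ 3 / 3) * s ^ (-4 : ℤ)

theorem differentiableAt_saddleIntegrand (a : ℝ) {s : ℂ} (hs : s ≠ 0) :
    DifferentiableAt ℂ (saddleIntegrand a) s := by
  unfold saddleIntegrand
  exact DifferentiableAt.mul (by fun_prop) (differentiableAt_zpow.mpr (Or.inl hs))

theorem norm_saddleIntegrand_le {a b x y : ℝ} (ha : 0 ≤ a) (hy : 1 ≤ y) (hyb : y ≤ b)
    (hab : a * b ≤ 1) :
    ‖saddleIntegrand a (x + y * Complex.I)‖ ≤ Real.exp (b ^ 2) * (1 + |x| ^ 2)⁻¹ := by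
  have hre : (-(x + y * Complex.I : ℂ) ^ 2 - Complex.I * a * (x + y * Complex.I) ^ 3 / 3).re =
      -x ^ 2 + y ^ 2 + a * (x ^ 2 * y - y ^ 3 / 3) := by
    have : (-(x + y * Complex.I : ℂ) ^ 2 - Complex.I * a * (x + y * Complex.I) ^ 3 / 3) =
        ((-x ^ 2 + y ^ 2 + a * (x ^ 2 * y - y ^ 3 / 3) : ℝ) : ℂ) +
        ((-2 * x * y - a * (x ^ 3 / 3 - x * y ^ 2) : ℝ) : ℂ) * Complex.I := by
      push_cast
      linear_combination (-y ^ 2 - x ^ 2 * y * a - a * x * y ^ 2 * Complex.I -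
        a * y ^ 3 / 3 * (Complex.I ^ 2 - 1)) * Complex.I_sq
    rw [this, Complex.add_re, Complex.ofReal_re, Complex.re_ofReal_mul, Complex.I_re, mul_zero,
      add_zero]
  rw [saddleIntegrand, norm_mul, Complex.norm_exp, hre, norm_zpow, sq_abs]
  have h := one_add_sq_le_norm_pow_four (x := x) hy
  gcongr
  · have h1 : a * y ≤ 1 := (mul_le_mul_of_nonneg_left hyb ha).trans hab
    have h2 : 0 ≤ a * y ^ 3 := by positivity
    nlinarith [mul_le_mul_of_nonneg_right h1 (sq_nonneg x)]
  · rw [zpow_neg]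
    exact inv_anti₀ (by positivity) (by exact_mod_cast h)

theorem continuous_saddleIntegrand_line (a : ℝ) {y : ℝ} (hy : 1 ≤ y) :
    Continuous fun x : ℝ => saddleIntegrand a (x + y * Complex.I) :=
  continuous_iff_continuousAt.mpr fun x =>
    (differentiableAt_saddleIntegrand a (add_mul_I_ne_zero hy)).continuousAt.comp
      (f := fun x : ℝ => (x + y * Complex.I : ℂ)) (by fun_prop)

theorem integrable_saddleIntegrand_line {a y : ℝ} (ha : 0 ≤ a) (hy : 1 ≤ y) (hay : a * y ≤ 1) :
    Integrable fun x : ℝ => saddleIntegrand a (x + y * Complex.I) := by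
  refine (integrable_inv_one_add_sq.const_mul (Real.exp (y ^ 2))).mono'
    (continuous_saddleIntegrand_line a hy).aestronglyMeasurable (.of_forall fun x => ?_)
  simpa using norm_saddleIntegrand_le (x := x) ha hy le_rfl hay

theorem integral_saddleIntegrand_shift {a b : ℝ} (ha : 0 ≤ a) (hb : 1 ≤ b) (hab : a * b ≤ 1) :
    ∫ x : ℝ, saddleIntegrand a (x + b * Complex.I) =
      ∫ x : ℝ, saddleIntegrand a (x + (1 : ℝ) * Complex.I) := by
  refine (integral_add_mul_I_eq_of_tendsto_zero
    (B := fun t => Real.exp (b ^ 2) * (1 + t ^ 2)⁻¹) hb ?_ ?_ ?_ ?_ ?_).symm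
  · intro s hs _
    refine differentiableAt_saddleIntegrand a fun h => ?_
    simp [h] at hs
    linarith
  · intro x y hy hyb
    exact norm_saddleIntegrand_le ha hy hyb hab
  · have h : Tendsto (fun t : ℝ => 1 + t ^ 2) atTop atTop :=
      tendsto_atTop_add_const_left _ _ (tendsto_pow_atTop two_ne_zero)
    simpa using h.inv_tendsto_atTop.const_mul (Real.exp (b ^ 2))
  · exact integrable_saddleIntegrand_line ha le_rfl (by nlinarith)
  · exact integrable_saddleIntegrand_line ha hb hab

theorem integral_saddleIntegrand_zero :
    ∫ x : ℝ, saddleIntegrand 0 (x + (1 : ℝ) * Complex.I) = 4 * Real.sqrt Real.pi / 3 := by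
  have hgauss_int : Integrable fun x : ℝ => Complex.exp (-(x + (1 : ℝ) * Complex.I) ^ 2) := by
    simpa using GaussianFourier.integrable_cexp_neg_mul_sq_add_real_mul_I (b := 1) (by simp) 1
  have hgauss : ∫ x : ℝ, Complex.exp (-(x + (1 : ℝ) * Complex.I) ^ 2) = Real.sqrt Real.pi := by
    have h := GaussianFourier.integral_cexp_neg_mul_sq_add_real_mul_I (b := 1) (by simp) 1
    rw [div_one, show (1 / 2 : ℂ) = ((1 / 2 : ℝ) : ℂ) by push_cast; rfl,
      ← Complex.ofReal_cpow Real.pi_pos.le, ← Real.sqrt_eq_rpow] at h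
    simpa using h
  have hint := integrable_saddleIntegrand_line (a := 0) (y := 1) le_rfl le_rfl (by simp)
  have hne : ∀ x : ℝ, (x + (1 : ℝ) * Complex.I : ℂ) ≠ 0 := fun x => add_mul_I_ne_zero le_rfl
  have hnorm : ∀ x : ℝ, 1 ≤ ‖(x + (1 : ℝ) * Complex.I : ℂ)‖ := fun x => by
    simpa using Complex.abs_im_le_norm (x + (1 : ℝ) * Complex.I : ℂ)
  let P : ℝ → ℂ := fun x => Complex.exp (-(x + (1 : ℝ) * Complex.I) ^ 2) *
    (-1 / 3 * ((x + (1 : ℝ) * Complex.I : ℂ)⁻¹) ^ 3 + 2 / 3 * (x + (1 : ℝ) * Complex.I : ℂ)⁻¹)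
  have hderiv : ∀ x : ℝ, HasDerivAt P (saddleIntegrand 0 (x + (1 : ℝ) * Complex.I) -
      4 / 3 * Complex.exp (-(x + (1 : ℝ) * Complex.I) ^ 2)) x := by
    intro x
    have hs : HasDerivAt (fun x : ℝ => (x + (1 : ℝ) * Complex.I : ℂ)) 1 x :=
      (Complex.ofRealCLM.hasDerivAt (x := x)).add_const _
    have hi := hs.inv (hne x)
    refine (((hs.pow 2).neg.cexp).mul
      (((hi.pow 3).const_mul (-1 / 3 : ℂ)).add (hi.const_mul (2 / 3 : ℂ)))).congr_deriv ?_
    have h0 := hne x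
    simp only [saddleIntegrand, Complex.ofReal_zero, mul_zero, zero_mul, zero_div, sub_zero,
      zpow_neg, zpow_ofNat, Pi.pow_apply, Pi.neg_apply, Pi.inv_apply, Pi.add_apply]
    generalize (x + (1 : ℝ) * Complex.I : ℂ) = s at h0 ⊢
    norm_num
    field_simp
    ring
  have hP_int : Integrable P := by
    refine (hgauss_int.norm.const_mul 1).mono' ?_ (.of_forall fun x => ?_)
    · exact (continuous_iff_continuousAt.mpr
        fun x => (hderiv x).continuousAt).aestronglyMeasurable
    · have h : ‖(x + (1 : ℝ) * Complex.I : ℂ)⁻¹‖ ≤ 1 := by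
        rw [norm_inv]
        exact inv_le_one_of_one_le₀ (hnorm x)
      rw [norm_mul, mul_comm]
      gcongr
      refine (norm_add_le _ _).trans ?_
      rw [norm_mul, norm_mul, norm_pow]
      have h3 := pow_le_one₀ (n := 3) (norm_nonneg _) h
      norm_num at h h3 ⊢
      linarith
  have hzero := integral_eq_zero_of_hasDerivAt_of_integrable hderiv
    (hint.sub (hgauss_int.const_mul _)) hP_int
  rw [integral_sub hint (hgauss_int.const_mul _), integral_const_mul, hgauss] at hzero
  linear_combination hzero

theorem norm_integral_saddleIntegrand_sub_le {a : ℝ} (ha : 0 ≤ a) (ha2 : a ≤ 1 / 2) :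
    ‖(∫ x : ℝ, saddleIntegrand a (x + (1 : ℝ) * Complex.I)) - 4 * Real.sqrt Real.pi / 3‖ ≤
      a * (Real.exp 1 * Real.sqrt (Real.pi / (1 / 2))) := by
  rw [← integral_saddleIntegrand_zero, ← integral_sub
    (integrable_saddleIntegrand_line ha le_rfl (by linarith))
    (integrable_saddleIntegrand_line le_rfl le_rfl (by simp)), ← integral_gaussian,
    ← integral_const_mul, ← integral_const_mul]
  refine norm_integral_le_of_norm_le
    (((integrable_exp_neg_mul_sq (by norm_num)).const_mul _).const_mul _)
    (.of_forall fun x => ?_)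
  have hnorm : 1 ≤ ‖(x + (1 : ℝ) * Complex.I : ℂ)‖ := by
    simpa using Complex.abs_im_le_norm (x + (1 : ℝ) * Complex.I : ℂ)
  set s : ℂ := x + (1 : ℝ) * Complex.I with hs
  have hfac : saddleIntegrand a s - saddleIntegrand 0 s =
      Complex.exp (-s ^ 2) * (Complex.exp (-(Complex.I * a * s ^ 3 / 3)) - 1) * s ^ (-4 : ℤ) := by
    simp only [saddleIntegrand, sub_eq_add_neg, Complex.exp_add]
    simp
    ring
  have hre2 : (-s ^ 2).re = 1 - x ^ 2 := by
    simp [hs, pow_succ]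
  have hre3 : (-(Complex.I * a * s ^ 3 / 3)).re = a * (x ^ 2 - 1 / 3) := by
    have : -(Complex.I * a * s ^ 3 / 3) = ((a * (x ^ 2 - 1 / 3) : ℝ) : ℂ) +
        ((-a * (x ^ 3 / 3 - x) : ℝ) : ℂ) * Complex.I := by
      rw [hs]
      push_cast
      linear_combination (-a * x ^ 2 - a * x * Complex.I -
        a / 3 * (Complex.I ^ 2 - 1)) * Complex.I_sq
    rw [this, Complex.add_re, Complex.ofReal_re, Complex.re_ofReal_mul, Complex.I_re, mul_zero,
      add_zero]
  have hexp := norm_cexp_sub_one_le_of_re_le (M := x ^ 2 / 2) (by positivity)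
    (u := -(Complex.I * a * s ^ 3 / 3)) (by rw [hre3]; nlinarith [sq_nonneg x])
  have hu : ‖-(Complex.I * a * s ^ 3 / 3)‖ = a * ‖s‖ ^ 3 / 3 := by
    simp [abs_of_nonneg ha]
  rw [hfac, norm_mul, norm_mul, Complex.norm_exp, hre2, norm_zpow]
  rw [hu] at hexp
  calc Real.exp (1 - x ^ 2) * ‖Complex.exp (-(Complex.I * a * s ^ 3 / 3)) - 1‖ * ‖s‖ ^ (-4 : ℤ)
      ≤ Real.exp (1 - x ^ 2) * (Real.exp (x ^ 2 / 2) * (a * ‖s‖ ^ 3 / 3)) * ‖s‖ ^ (-4 : ℤ) := by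
        gcongr
    _ = a * (Real.exp 1 * Real.exp (-(1 / 2) * x ^ 2)) * (3 * ‖s‖)⁻¹ := by
        rw [← Real.exp_add, show (1 : ℝ) + -(1 / 2) * x ^ 2 = (1 - x ^ 2) + x ^ 2 / 2 by ring,
          Real.exp_add, zpow_neg]
        norm_cast
        field_simp
    _ ≤ a * (Real.exp 1 * Real.exp (-(1 / 2) * x ^ 2)) * 1 := by
        gcongr
        exact inv_le_one_of_one_le₀ (by linarith)
    _ = _ := mul_one _

theorem integral_airy_type_eq {a : ℝ} (ha : 0 < a) :
    (∫ z : ℝ, Complex.exp (-(Complex.I / (a : ℂ) ^ 2) * ((z : ℂ) ^ 3 / 3 + (z : ℂ))) *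
        ((z : ℂ) + Complex.I) ^ (-4 : ℤ)) =
      ((Real.exp (-2 / (3 * a ^ 2)) * (a ^ 3)⁻¹ : ℝ) : ℂ) *
        ∫ x : ℝ, saddleIntegrand a (x + (a⁻¹ : ℝ) * Complex.I) := by
  have h0 : (a : ℂ) ≠ 0 := by exact_mod_cast ha.ne'
  have hscale := Measure.integral_comp_mul_left (fun z : ℝ =>
    Complex.exp (-(Complex.I / (a : ℂ) ^ 2) * ((z : ℂ) ^ 3 / 3 + (z : ℂ))) *
        ((z : ℂ) + Complex.I) ^ (-4 : ℤ)) a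
  have hpoint : ∀ x : ℝ,
      Complex.exp (-(Complex.I / (a : ℂ) ^ 2) * (((a * x : ℝ) : ℂ) ^ 3 / 3 + ((a * x : ℝ) : ℂ))) *
        (((a * x : ℝ) : ℂ) + Complex.I) ^ (-4 : ℤ) =
      ((Real.exp (-2 / (3 * a ^ 2)) * (a ^ 4)⁻¹ : ℝ) : ℂ) *
        saddleIntegrand a (x + (a⁻¹ : ℝ) * Complex.I) := by
    intro x
    have hlin : ((a * x : ℝ) : ℂ) + Complex.I = a * (x + (a⁻¹ : ℝ) * Complex.I) := by
      push_cast
      field_simp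
    have hphase : -(Complex.I / (a : ℂ) ^ 2) * (((a * x : ℝ) : ℂ) ^ 3 / 3 + ((a * x : ℝ) : ℂ)) =
        ((-2 / (3 * a ^ 2) : ℝ) : ℂ) + (-(x + (a⁻¹ : ℝ) * Complex.I : ℂ) ^ 2 -
          Complex.I * a * (x + (a⁻¹ : ℝ) * Complex.I) ^ 3 / 3) := by
      push_cast
      field_simp
      linear_combination (3 * Complex.I * x * a + 3 * x ^ 2 * a ^ 2 + (Complex.I ^ 2 + 2)) *
        Complex.I_sq
    rw [saddleIntegrand, hphase, Complex.exp_add, hlin, mul_zpow]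
    simp only [zpow_neg]
    push_cast
    norm_cast
    ring
  simp only [hpoint] at hscale
  rw [integral_const_mul, abs_of_pos (inv_pos.mpr ha), Complex.real_smul] at hscale
  have h : (a : ℂ) * (((a⁻¹ : ℝ) : ℂ) * ∫ z : ℝ,
      Complex.exp (-(Complex.I / (a : ℂ) ^ 2) * ((z : ℂ) ^ 3 / 3 + (z : ℂ))) *
        ((z : ℂ) + Complex.I) ^ (-4 : ℤ)) = ∫ z : ℝ,
      Complex.exp (-(Complex.I / (a : ℂ) ^ 2) * ((z : ℂ) ^ 3 / 3 + (z : ℂ))) *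
        ((z : ℂ) + Complex.I) ^ (-4 : ℤ) := by
    push_cast
    field_simp
  rw [← h, ← hscale, ← mul_assoc]
  congr 1
  push_cast
  field_simp

/-- Asymptotics of `∫ e^{−(i/ε³)(z³/3 + z)} (z+i)^{−4} dz` as `ε → 0⁺`:
it equals `(4√π/3) ε^{−9/2} e^{−2/(3ε³)} + O(ε^{−3} e^{−2/(3ε³)})`. -/
theorem airy_type_asymptotics :
    ∃ C > (0 : ℝ), ∃ ε₁ > (0 : ℝ), ∀ ε : ℝ, 0 < ε → ε < ε₁ →
      ‖(∫ z : ℝ,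
            Complex.exp (-(Complex.I / (ε : ℂ) ^ 3) * ((z : ℂ) ^ 3 / 3 + (z : ℂ))) *
              ((z : ℂ) + Complex.I) ^ (-4 : ℤ))
          - (((4 * Real.sqrt Real.pi / 3) * ε ^ (-(9 : ℝ) / 2) *
              Real.exp (-2 / (3 * ε ^ 3)) : ℝ) : ℂ)‖
        ≤ C * ε ^ (-(3 : ℝ)) * Real.exp (-2 / (3 * ε ^ 3)) := by
  refine ⟨Real.exp 1 * Real.sqrt (Real.pi / (1 / 2)), by positivity, 1 / 2, by norm_num,
    fun ε hε hε1 => ?_⟩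
  set a : ℝ := ε ^ (3 / 2 : ℝ) with ha_def
  have ha : 0 < a := by positivity
  have ha2 : a ≤ 1 / 2 :=
    (Real.rpow_le_rpow_of_exponent_ge hε (by linarith) (by norm_num : (1 : ℝ) ≤ 3 / 2)).trans
      (by rw [Real.rpow_one]; exact hε1.le)
  have hsq : ε ^ 3 = a ^ 2 := by
    rw [ha_def, ← Real.rpow_natCast, ← Real.rpow_natCast, ← Real.rpow_mul hε.le]
    norm_num
  have h9 : ε ^ (-(9 : ℝ) / 2) = (a ^ 3)⁻¹ := by
    rw [ha_def, ← Real.rpow_natCast, ← Real.rpow_mul hε.le, ← Real.rpow_neg hε.le]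
    norm_num
  have h3 : ε ^ (-(3 : ℝ)) = (a ^ 2)⁻¹ := by
    rw [← hsq, Real.rpow_neg hε.le]
    norm_cast
  have hsqC : (ε : ℂ) ^ 3 = (a : ℂ) ^ 2 := by exact_mod_cast hsq
  rw [hsqC, h9, h3, hsq, integral_airy_type_eq ha, integral_saddleIntegrand_shift ha.le
    ((one_le_inv₀ ha).mpr (by linarith)) (mul_inv_cancel₀ ha.ne').le]
  have hmain := norm_integral_saddleIntegrand_sub_le ha.le ha2
  set J := ∫ x : ℝ, saddleIntegrand a (x + (1 : ℝ) * Complex.I)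
  have hfac : ((Real.exp (-2 / (3 * a ^ 2)) * (a ^ 3)⁻¹ : ℝ) : ℂ) * J -
      ((4 * Real.sqrt Real.pi / 3 * (a ^ 3)⁻¹ * Real.exp (-2 / (3 * a ^ 2)) : ℝ) : ℂ) =
      ((Real.exp (-2 / (3 * a ^ 2)) * (a ^ 3)⁻¹ : ℝ) : ℂ) *
        (J - 4 * Real.sqrt Real.pi / 3) := by
    push_cast
    ring
  rw [hfac, norm_mul, Complex.norm_of_nonneg (by positivity)]
  calc _ ≤ Real.exp (-2 / (3 * a ^ 2)) * (a ^ 3)⁻¹ *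
        (a * (Real.exp 1 * Real.sqrt (Real.pi / (1 / 2)))) := by gcongr
    _ = _ := by field_simp
end

section
/- There exist constants C > 0 and ε₁ > 0 such that for all ε ∈ (0, ε₁), |∫_{−∞}^{∞} e^{−(i/(2ε³))(z³/3 + z)} (z + i)^{−4} (z − i)^{−2} dz + (√(2π)/12) ε^{−9/2} e^{−1/(3ε³)}| ≤ C ε^{−3} e^{−1/(3ε³)}. -/
open MeasureTheory

open Complex Filter Topology Set in
/-- The integral of a holomorphic function along a horizontal line does not change when the line is
moved within a strip on which the function decays quadratically. -/
theorem integral_add_mul_I_eq_of_norm_le {f : ℂ → ℂ} {a b C : ℝ} (hab : a ≤ b)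
    (hf : DifferentiableOn ℂ f (im ⁻¹' Icc a b))
    (hC : ∀ x y : ℝ, y ∈ Icc a b → ‖f (x + y * I)‖ ≤ C * (1 + x ^ 2)⁻¹) :
    ∫ x : ℝ, f (x + a * I) = ∫ x : ℝ, f (x + b * I) := by
  have integrable_line : ∀ y ∈ Icc a b, Integrable fun x : ℝ => f (x + y * I) := by
    intro y hy
    refine (integrable_inv_one_add_sq.const_mul C).mono' ?_ (.of_forall fun x => hC x y hy)
    refine (hf.continuousOn.comp_continuous (by fun_prop) fun x => ?_).aestronglyMeasurable
    simpa using hy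
  have tendsto_side : ∀ s : ℝ → ℝ, (∀ T, s T ^ 2 = T ^ 2) →
      Tendsto (fun T : ℝ => ∫ y : ℝ in a..b, f (s T + y * I)) atTop (𝓝 0) := by
    intro s hs
    have hlim : Tendsto (fun T : ℝ => C * (1 + T ^ 2)⁻¹ * |b - a|) atTop (𝓝 0) := by
      have h : Tendsto (fun T : ℝ => (1 + T ^ 2)⁻¹) atTop (𝓝 0) :=
        tendsto_inv_atTop_zero.comp
          (tendsto_atTop_add_const_left _ _ (tendsto_pow_atTop two_ne_zero))
      simpa using (h.const_mul C).mul_const |b - a|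
    refine squeeze_zero_norm (fun T => ?_) hlim
    refine intervalIntegral.norm_integral_le_of_norm_le_const fun y hy => ?_
    rw [uIoc_of_le hab] at hy
    simpa [hs] using hC (s T) y (Ioc_subset_Icc_self hy)
  have tendsto_line : ∀ y ∈ Icc a b,
      Tendsto (fun T : ℝ => ∫ x : ℝ in -T..T, f (x + y * I)) atTop
        (𝓝 (∫ x : ℝ, f (x + y * I))) := fun y hy =>
    intervalIntegral_tendsto_integral (integrable_line y hy) tendsto_neg_atTop_atBot tendsto_id
  have hrect : ∀ T : ℝ,
      (∫ x : ℝ in -T..T, f (x + a * I)) - (∫ x : ℝ in -T..T, f (x + b * I)) +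
        I • (∫ y : ℝ in a..b, f (T + y * I)) -
        I • (∫ y : ℝ in a..b, f ((-T : ℝ) + y * I)) = 0 := by
    intro T
    have h := integral_boundary_rect_eq_zero_of_differentiableOn f ⟨-T, a⟩ ⟨T, b⟩
      (hf.mono fun z hz => by simpa [uIcc_of_le hab] using hz.2)
    simpa using h
  have hlim := (((tendsto_line a (left_mem_Icc.2 hab)).sub
    (tendsto_line b (right_mem_Icc.2 hab))).add
      ((tendsto_side id fun _ => rfl).const_smul I)).sub
      ((tendsto_side (fun T => -T) fun T => neg_sq T).const_smul I)
  have h0 := tendsto_nhds_unique hlim (tendsto_const_nhds.congr fun T => (hrect T).symm)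
  simpa [sub_eq_zero] using h0

/-- A quantitative form of `exp w - 1 = O(w)` on half-planes. -/
theorem Complex.norm_exp_sub_one_le_of_re_le {w : ℂ} {M : ℝ} (hM : 0 ≤ M) (hw : w.re ≤ M) :
    ‖Complex.exp w - 1‖ ≤ Real.exp M * ‖w‖ := by
  have h := (convex_halfSpace_re_le M).norm_image_sub_le_of_norm_deriv_le (f := Complex.exp)
    (C := Real.exp M) (fun z _ => Complex.differentiableAt_exp)
    (fun z hz => by simpa [Complex.norm_exp] using hz) (x := 0) (y := w) (by simpa using hM) hw
  simpa using h

theorem Complex.add_I_ne_zero (x : ℝ) : (x : ℂ) + Complex.I ≠ 0 := fun h => by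
  simpa using congrArg Complex.im h

theorem Complex.one_le_norm_add_I (x : ℝ) : 1 ≤ ‖(x : ℂ) + Complex.I‖ := by
  simpa using Complex.abs_im_le_norm ((x : ℂ) + Complex.I)

theorem Complex.norm_exp_neg_add_I_sq (x : ℝ) :
    ‖Complex.exp (-((x : ℂ) + Complex.I) ^ 2)‖ = Real.exp (1 - x ^ 2) := by
  rw [Complex.norm_exp]
  congr 1
  simp [pow_two]

theorem integrable_cexp_neg_add_I_sq :
    Integrable fun x : ℝ => Complex.exp (-((x : ℂ) + Complex.I) ^ 2) := by
  simpa using GaussianFourier.integrable_cexp_neg_mul_sq_add_real_mul_I (b := 1) (by simp) 1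

theorem integral_cexp_neg_add_I_sq :
    ∫ x : ℝ, Complex.exp (-((x : ℂ) + Complex.I) ^ 2) = (Real.sqrt Real.pi : ℂ) := by
  have h := GaussianFourier.integral_cexp_neg_mul_sq_add_real_mul_I (b := 1) (by simp) 1
  rw [Real.sqrt_eq_rpow, Complex.ofReal_cpow Real.pi_pos.le]
  simpa using h

theorem integrable_cexp_neg_add_I_sq_mul_inv_pow (n : ℕ) :
    Integrable fun x : ℝ =>
      Complex.exp (-((x : ℂ) + Complex.I) ^ 2) * (((x : ℂ) + Complex.I) ^ n)⁻¹ := by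
  refine integrable_cexp_neg_add_I_sq.mul_bdd (c := 1) ?_ (.of_forall fun x => ?_)
  · refine Continuous.aestronglyMeasurable (Continuous.inv₀ (by fun_prop) fun x => ?_)
    exact pow_ne_zero _ (Complex.add_I_ne_zero x)
  · rw [norm_inv, norm_pow]
    exact inv_le_one_of_one_le₀ (one_le_pow₀ (Complex.one_le_norm_add_I x))

/-- The contour integral representing `Γ(-3/2) = 4√π/3`. -/
theorem integral_cexp_neg_add_I_sq_mul_inv_pow_four :
    ∫ x : ℝ, Complex.exp (-((x : ℂ) + Complex.I) ^ 2) * (((x : ℂ) + Complex.I) ^ 4)⁻¹ =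
      4 / 3 * (Real.sqrt Real.pi : ℂ) := by
  have hderiv : ∀ x : ℝ, HasDerivAt (fun x : ℝ =>
      2 / 3 * (Complex.exp (-((x : ℂ) + Complex.I) ^ 2) * (((x : ℂ) + Complex.I) ^ 1)⁻¹) -
        1 / 3 * (Complex.exp (-((x : ℂ) + Complex.I) ^ 2) * (((x : ℂ) + Complex.I) ^ 3)⁻¹))
      (Complex.exp (-((x : ℂ) + Complex.I) ^ 2) * (((x : ℂ) + Complex.I) ^ 4)⁻¹ -
        4 / 3 * Complex.exp (-((x : ℂ) + Complex.I) ^ 2)) x := by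
    intro x
    have hv0 := Complex.add_I_ne_zero x
    have hv : HasDerivAt (fun x : ℝ => (x : ℂ) + Complex.I) 1 x :=
      Complex.ofRealCLM.hasDerivAt.add_const _
    have he := (hv.pow 2).neg.cexp
    refine HasDerivAt.congr_deriv (((he.mul ((hv.pow 1).inv (pow_ne_zero 1 hv0))).const_mul (2 / 3)).sub
      ((he.mul ((hv.pow 3).inv (pow_ne_zero 3 hv0))).const_mul (1 / 3))) ?_
    simp only [Pi.neg_apply, Pi.pow_apply, Pi.inv_apply]
    field_simp
    ring
  have h4 := integrable_cexp_neg_add_I_sq_mul_inv_pow 4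
  have h0 := integrable_cexp_neg_add_I_sq.const_mul (4 / 3)
  have h := integral_eq_zero_of_hasDerivAt_of_integrable hderiv (h4.sub h0)
    (((integrable_cexp_neg_add_I_sq_mul_inv_pow 1).const_mul _).sub
      ((integrable_cexp_neg_add_I_sq_mul_inv_pow 3).const_mul _))
  rw [integral_sub h4 h0, integral_const_mul, integral_cexp_neg_add_I_sq] at h
  exact sub_eq_zero.1 h

/-- The integrand rescaled around the saddle point `-i`, compared with its limit as `m → 0`. -/
theorem norm_rescaled_sub_limit_le {m : ℝ} (hm : 0 < m) (hm2 : m ≤ 1 / 2) (u : ℝ) :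
    ‖Complex.exp (-((u : ℂ) + Complex.I) ^ 2) * (((u : ℂ) + Complex.I) ^ 4)⁻¹ *
        (Complex.exp (-(Complex.I * m * ((u : ℂ) + Complex.I) ^ 3 / 3)) *
          ((m * ((u : ℂ) + Complex.I) - 2 * Complex.I) ^ 2)⁻¹ + 1 / 4)‖ ≤
      m * (2 * Real.exp 1 * Real.exp (-(1 / 2) * u ^ 2)) := by
  have hE := Complex.norm_exp_neg_add_I_sq u
  have hr := Complex.one_le_norm_add_I u
  have hre : (-(Complex.I * m * ((u : ℂ) + Complex.I) ^ 3 / 3)).re ≤ u ^ 2 / 2 := by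
    have : (-(Complex.I * m * ((u : ℂ) + Complex.I) ^ 3 / 3)).re = m * (u ^ 2 - 1 / 3) := by
      rw [show -(Complex.I * m * ((u : ℂ) + Complex.I) ^ 3 / 3) =
        ((m * (u ^ 2 - 1 / 3) : ℝ) : ℂ) + ((m * (u - u ^ 3 / 3) : ℝ) : ℂ) * Complex.I by
          push_cast
          linear_combination (-(m : ℂ) * (u ^ 2 + u * Complex.I + (Complex.I ^ 2 - 1) / 3))
            * Complex.I_sq]
      simp only [Complex.add_re, Complex.re_ofReal_mul, Complex.I_re, mul_zero, add_zero,
        Complex.ofReal_re]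
    rw [this]
    nlinarith [sq_nonneg u]
  have hexp := Complex.norm_exp_sub_one_le_of_re_le (by positivity) hre
  have hnorm : ‖-(Complex.I * m * ((u : ℂ) + Complex.I) ^ 3 / 3)‖ =
      m * ‖(u : ℂ) + Complex.I‖ ^ 3 / 3 := by
    simp [abs_of_pos hm]
  rw [hnorm] at hexp
  have hq : 1 ≤ ‖m * ((u : ℂ) + Complex.I) - 2 * Complex.I‖ := by
    refine le_trans ?_ (Complex.abs_im_le_norm _)
    simp only [Complex.sub_im, Complex.mul_im, Complex.add_im, Complex.ofReal_re, Complex.ofReal_im,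
      Complex.I_re, Complex.I_im, Complex.re_ofNat, Complex.im_ofNat]
    rw [le_abs]
    right
    linarith
  set v : ℂ := (u : ℂ) + Complex.I
  set q : ℂ := m * v - 2 * Complex.I with hq_def
  set a : ℂ := -(Complex.I * m * v ^ 3 / 3)
  have hq0 : q ≠ 0 := norm_pos_iff.1 (by linarith)
  have hqinv : ‖(q ^ 2)⁻¹‖ ≤ 1 := by
    rw [norm_inv, norm_pow]
    exact inv_le_one_of_one_le₀ (one_le_pow₀ hq)
  have hquarter : ‖(q ^ 2)⁻¹ + 1 / 4‖ ≤ 3 / 4 * (m * ‖v‖) := by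
    have h1 : (q ^ 2)⁻¹ + 1 / 4 = m * v * (q - 2 * Complex.I) / (4 * q ^ 2) := by
      have : m * v = q + 2 * Complex.I := by rw [hq_def]; ring
      rw [this]
      field_simp
      linear_combination 4 * Complex.I_sq
    have h2 : ‖q - 2 * Complex.I‖ ≤ ‖q‖ + 2 := by
      simpa using norm_sub_le q (2 * Complex.I)
    have h3 : 0 ≤ m * ‖v‖ := by positivity
    rw [h1, norm_div, norm_mul, norm_mul, norm_mul, norm_pow, Complex.norm_real, Real.norm_eq_abs,
      abs_of_pos hm, Complex.norm_ofNat, div_le_iff₀ (by positivity)]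
    have h4 : ‖q - 2 * Complex.I‖ ≤ 3 * ‖q‖ ^ 2 := by nlinarith
    nlinarith
  have hsum : ‖Complex.exp a * (q ^ 2)⁻¹ + 1 / 4‖ ≤
      Real.exp (u ^ 2 / 2) * (m * ‖v‖ ^ 3 / 3) + 3 / 4 * (m * ‖v‖) := by
    rw [show Complex.exp a * (q ^ 2)⁻¹ + 1 / 4 =
      (Complex.exp a - 1) * (q ^ 2)⁻¹ + ((q ^ 2)⁻¹ + 1 / 4) by ring]
    refine (norm_add_le _ _).trans (add_le_add ?_ hquarter)
    rw [norm_mul]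
    exact (mul_le_of_le_one_right (norm_nonneg _) hqinv).trans hexp
  have hsum' : ‖Complex.exp a * (q ^ 2)⁻¹ + 1 / 4‖ ≤
      2 * m * Real.exp (u ^ 2 / 2) * ‖v‖ ^ 4 := by
    have he : 1 ≤ Real.exp (u ^ 2 / 2) := Real.one_le_exp (by positivity)
    have h3 : ‖v‖ ^ 3 ≤ ‖v‖ ^ 4 := pow_le_pow_right₀ hr (by norm_num)
    have h1 : ‖v‖ ≤ ‖v‖ ^ 4 := le_self_pow₀ hr (by norm_num)
    calc _ ≤ _ := hsum
      _ ≤ Real.exp (u ^ 2 / 2) * (m * ‖v‖ ^ 4 / 3) +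
          Real.exp (u ^ 2 / 2) * (3 / 4 * (m * ‖v‖ ^ 4)) := by
        refine add_le_add (by gcongr) ?_
        exact le_trans (b := 3 / 4 * (m * ‖v‖ ^ 4)) (by gcongr)
          (le_mul_of_one_le_left (by positivity) he)
      _ = 13 / 12 * (m * Real.exp (u ^ 2 / 2) * ‖v‖ ^ 4) := by ring
      _ ≤ 2 * (m * Real.exp (u ^ 2 / 2) * ‖v‖ ^ 4) := by gcongr; norm_num
      _ = _ := by ring
  have hv4 : 0 < ‖v‖ ^ 4 := by positivity
  calc _ = Real.exp (1 - u ^ 2) * (‖v‖ ^ 4)⁻¹ * ‖Complex.exp a * (q ^ 2)⁻¹ + 1 / 4‖ := by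
        rw [norm_mul, norm_mul, norm_inv, norm_pow, hE]
    _ ≤ Real.exp (1 - u ^ 2) * (‖v‖ ^ 4)⁻¹ *
        (2 * m * Real.exp (u ^ 2 / 2) * ‖v‖ ^ 4) := by gcongr
    _ = 2 * m * (Real.exp (1 - u ^ 2) * Real.exp (u ^ 2 / 2)) := by field_simp
    _ = m * (2 * (Real.exp 1 * Real.exp (-(1 / 2) * u ^ 2))) := by
        rw [← Real.exp_add, ← Real.exp_add]
        ring_nf
    _ = _ := by ring

/-- The saddle point approximation of the rescaled integral, with an error linear in `m`. -/
theorem norm_integral_rescaled_add_le {m : ℝ} (hm : 0 < m) (hm2 : m ≤ 1 / 2) :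
    ‖(∫ u : ℝ, Complex.exp (-((u : ℂ) + Complex.I) ^ 2) * (((u : ℂ) + Complex.I) ^ 4)⁻¹ *
        (Complex.exp (-(Complex.I * m * ((u : ℂ) + Complex.I) ^ 3 / 3)) *
          ((m * ((u : ℂ) + Complex.I) - 2 * Complex.I) ^ 2)⁻¹)) +
        (Real.sqrt Real.pi : ℂ) / 3‖ ≤
      m * ∫ u : ℝ, 2 * Real.exp 1 * Real.exp (-(1 / 2) * u ^ 2) := by
  have hdom : Integrable fun u : ℝ => m * (2 * Real.exp 1 * Real.exp (-(1 / 2) * u ^ 2)) :=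
    ((integrable_exp_neg_mul_sq (by norm_num)).const_mul _).const_mul _
  have hlim := (integrable_cexp_neg_add_I_sq_mul_inv_pow 4).mul_const (1 / 4)
  have hbound := norm_rescaled_sub_limit_le hm hm2
  have hq0 : ∀ u : ℝ, (m * ((u : ℂ) + Complex.I) - 2 * Complex.I) ≠ 0 := by
    intro u h
    have := congrArg Complex.im h
    simp at this
    linarith
  have hdiff : Integrable fun u : ℝ =>
      Complex.exp (-((u : ℂ) + Complex.I) ^ 2) * (((u : ℂ) + Complex.I) ^ 4)⁻¹ *
        (Complex.exp (-(Complex.I * m * ((u : ℂ) + Complex.I) ^ 3 / 3)) *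
          ((m * ((u : ℂ) + Complex.I) - 2 * Complex.I) ^ 2)⁻¹ + 1 / 4) := by
    refine hdom.mono' (Continuous.aestronglyMeasurable ?_) (.of_forall hbound)
    have h1 : Continuous fun u : ℝ => (((u : ℂ) + Complex.I) ^ 4)⁻¹ :=
      Continuous.inv₀ (by fun_prop) fun u => pow_ne_zero _ (Complex.add_I_ne_zero u)
    have h2 : Continuous fun u : ℝ => ((m * ((u : ℂ) + Complex.I) - 2 * Complex.I) ^ 2)⁻¹ :=
      Continuous.inv₀ (by fun_prop) fun u => pow_ne_zero _ (hq0 u)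
    fun_prop
  have heq := integral_sub hdiff hlim
  simp only [← mul_sub, add_sub_cancel_right] at heq
  rw [integral_mul_const, integral_cexp_neg_add_I_sq_mul_inv_pow_four] at heq
  rw [heq, ← integral_const_mul,
    show ∀ J s : ℂ, J - 4 / 3 * s * (1 / 4) + s / 3 = J from fun J s => by ring]
  exact norm_integral_le_of_norm_le hdom (.of_forall hbound)

/-- The integrand, with `ε` replaced by the width `m = √(2ε³)` of the saddle. -/
noncomputable def airyIntegrand (m : ℝ) (z : ℂ) : ℂ :=
  Complex.exp (-(Complex.I / (m : ℂ) ^ 2) * (z ^ 3 / 3 + z)) *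
    (z + Complex.I) ^ (-4 : ℤ) * (z - Complex.I) ^ (-2 : ℤ)

theorem integral_airyIntegrand_eq {m : ℝ} (hm : 0 < m) (hm1 : m ≤ 1) :
    ∫ x : ℝ, airyIntegrand m x = ∫ x : ℝ, airyIntegrand m (x + (m - 1 : ℝ) * Complex.I) := by
  rw [integral_add_mul_I_eq_of_norm_le (f := airyIntegrand m) (b := 0) (C := (m ^ 4)⁻¹)
    (by linarith)]
  · simp
  · intro z hz
    have h1 : z + Complex.I ≠ 0 := fun h => by
      have := congrArg Complex.im h
      simp at this
      linarith [hz.1]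
    have h2 : z - Complex.I ≠ 0 := fun h => by
      have := congrArg Complex.im h
      simp at this
      linarith [hz.2]
    unfold airyIntegrand
    refine DifferentiableAt.differentiableWithinAt ?_
    refine DifferentiableAt.mul (DifferentiableAt.mul (by fun_prop) ?_) ?_
    · exact DifferentiableAt.zpow (by fun_prop) (.inl h1)
    · exact DifferentiableAt.zpow (by fun_prop) (.inl h2)
  · rintro x y ⟨hy1, hy2⟩
    have hexp : ‖Complex.exp (-(Complex.I / (m : ℂ) ^ 2) *
        ((x + y * Complex.I) ^ 3 / 3 + (x + y * Complex.I)))‖ ≤ 1 := by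
      rw [Complex.norm_exp, Real.exp_le_one_iff]
      rw [show -(Complex.I / (m : ℂ) ^ 2) * ((x + y * Complex.I) ^ 3 / 3 + (x + y * Complex.I)) =
        (((m ^ 2)⁻¹ * (y * (x ^ 2 + 1 - y ^ 2 / 3)) : ℝ) : ℂ) +
          (((m ^ 2)⁻¹ * (x * y ^ 2 - x ^ 3 / 3 - x) : ℝ) : ℂ) * Complex.I by
        push_cast
        linear_combination (-((m : ℂ) ^ 2)⁻¹ * (x ^ 2 * y + y + x * y ^ 2 * Complex.I
            + y ^ 3 * (Complex.I ^ 2 - 1) / 3)) * Complex.I_sq]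
      simp only [Complex.add_re, Complex.re_ofReal_mul, Complex.I_re, mul_zero, add_zero,
        Complex.ofReal_re]
      have : 0 ≤ x ^ 2 + 1 - y ^ 2 / 3 := by nlinarith [sq_nonneg x]
      exact mul_nonpos_of_nonneg_of_nonpos (by positivity) (mul_nonpos_of_nonpos_of_nonneg hy2 this)
    have hsub : ‖(x + y * Complex.I - Complex.I) ^ (-2 : ℤ)‖ ≤ 1 := by
      rw [norm_zpow]
      refine zpow_le_one_of_nonpos₀ (le_trans ?_ (Complex.abs_im_le_norm _)) (by norm_num)
      simp [le_abs]
      right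
      linarith
    have hadd : ‖(x + y * Complex.I + Complex.I) ^ (-4 : ℤ)‖ ≤ (m ^ 4)⁻¹ * (1 + x ^ 2)⁻¹ := by
      have hn : ‖(x : ℂ) + y * Complex.I + Complex.I‖ ^ 2 = x ^ 2 + (y + 1) ^ 2 := by
        rw [← Complex.normSq_eq_norm_sq, Complex.normSq_apply]
        simp
        ring
      have hle : m ^ 2 * (1 + x ^ 2) ≤ x ^ 2 + (y + 1) ^ 2 := by
        have : m ^ 2 ≤ 1 := by nlinarith
        nlinarith [sq_nonneg x]
      rw [norm_zpow, zpow_neg, ← mul_inv,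
        show ((4 : ℤ)) = ((4 : ℕ) : ℤ) from rfl, zpow_natCast]
      refine inv_anti₀ (by positivity) ?_
      calc m ^ 4 * (1 + x ^ 2) ≤ m ^ 4 * (1 + x ^ 2) ^ 2 := by
            gcongr
            exact le_self_pow₀ (by nlinarith [sq_nonneg x]) two_ne_zero
        _ = (m ^ 2 * (1 + x ^ 2)) ^ 2 := by ring
        _ ≤ (‖(x : ℂ) + y * Complex.I + Complex.I‖ ^ 2) ^ 2 := by rw [hn]; gcongr
        _ = _ := by ring
    unfold airyIntegrand
    rw [norm_mul, norm_mul]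
    calc _ ≤ 1 * ((m ^ 4)⁻¹ * (1 + x ^ 2)⁻¹) * 1 := by gcongr
      _ = _ := by ring

theorem airyIntegrand_rescale {m : ℝ} (hm : 0 < m) (u : ℝ) :
    airyIntegrand m ((m * u : ℝ) + (m - 1 : ℝ) * Complex.I) =
      ((m ^ 4)⁻¹ * Real.exp (-2 / (3 * m ^ 2)) : ℝ) *
        (Complex.exp (-((u : ℂ) + Complex.I) ^ 2) * (((u : ℂ) + Complex.I) ^ 4)⁻¹ *
        (Complex.exp (-(Complex.I * m * ((u : ℂ) + Complex.I) ^ 3 / 3)) *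
          ((m * ((u : ℂ) + Complex.I) - 2 * Complex.I) ^ 2)⁻¹)) := by
  have hm0 : (m : ℂ) ≠ 0 := by exact_mod_cast hm.ne'
  have hz : ((m * u : ℝ) : ℂ) + (m - 1 : ℝ) * Complex.I =
      m * ((u : ℂ) + Complex.I) - Complex.I := by
    push_cast
    ring
  rw [hz, airyIntegrand]
  set v : ℂ := (u : ℂ) + Complex.I
  have hexp : -(Complex.I / (m : ℂ) ^ 2) * ((m * v - Complex.I) ^ 3 / 3 + (m * v - Complex.I)) =
      ((-2 / (3 * m ^ 2) : ℝ) : ℂ) + (-v ^ 2 + -(Complex.I * m * v ^ 3 / 3)) := by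
    push_cast
    field_simp
    linear_combination (3 * m ^ 2 * v ^ 2 - 3 * m * v * Complex.I + Complex.I ^ 2 + 2)
      * Complex.I_sq
  rw [hexp, Complex.exp_add, Complex.exp_add, sub_add_cancel, zpow_neg, zpow_neg,
    show m * v - Complex.I - Complex.I = m * v - 2 * Complex.I by ring,
    show ((4 : ℤ)) = ((4 : ℕ) : ℤ) from rfl, show ((2 : ℤ)) = ((2 : ℕ) : ℤ) from rfl,
    zpow_natCast, zpow_natCast, mul_pow, mul_inv]
  push_cast
  ring

theorem norm_integral_airyIntegrand_add_le {m : ℝ} (hm : 0 < m) (hm2 : m ≤ 1 / 2) :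
    ‖(∫ x : ℝ, airyIntegrand m x) +
        ((Real.sqrt Real.pi / 3 * (m ^ 3)⁻¹ * Real.exp (-2 / (3 * m ^ 2)) : ℝ) : ℂ)‖ ≤
      (∫ u : ℝ, 2 * Real.exp 1 * Real.exp (-(1 / 2) * u ^ 2)) *
        (m ^ 2)⁻¹ * Real.exp (-2 / (3 * m ^ 2)) := by
  have hm0 : (m : ℂ) ≠ 0 := by exact_mod_cast hm.ne'
  have hscale := Measure.integral_comp_mul_left
    (fun x : ℝ => airyIntegrand m (x + (m - 1 : ℝ) * Complex.I)) m
  simp only [airyIntegrand_rescale hm] at hscale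
  rw [integral_const_mul, abs_of_pos (inv_pos.2 hm), ← integral_airyIntegrand_eq hm (by linarith),
    Complex.real_smul] at hscale
  have hJ := norm_integral_rescaled_add_le hm hm2
  set J : ℂ := ∫ u : ℝ, Complex.exp (-((u : ℂ) + Complex.I) ^ 2) *
    (((u : ℂ) + Complex.I) ^ 4)⁻¹ *
      (Complex.exp (-(Complex.I * m * ((u : ℂ) + Complex.I) ^ 3 / 3)) *
        ((m * ((u : ℂ) + Complex.I) - 2 * Complex.I) ^ 2)⁻¹)
  have hI : ∫ x : ℝ, airyIntegrand m x =
      (((m ^ 3)⁻¹ * Real.exp (-2 / (3 * m ^ 2)) : ℝ) : ℂ) * J := by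
    calc ∫ x : ℝ, airyIntegrand m x =
        m * (((m⁻¹ : ℝ) : ℂ) * ∫ x : ℝ, airyIntegrand m x) := by
          push_cast
          field_simp
      _ = _ := by
          rw [← hscale]
          push_cast
          field_simp
  rw [hI, show (((m ^ 3)⁻¹ * Real.exp (-2 / (3 * m ^ 2)) : ℝ) : ℂ) * J +
      ((Real.sqrt Real.pi / 3 * (m ^ 3)⁻¹ * Real.exp (-2 / (3 * m ^ 2)) : ℝ) : ℂ) =
      (((m ^ 3)⁻¹ * Real.exp (-2 / (3 * m ^ 2)) : ℝ) : ℂ) *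
        (J + (Real.sqrt Real.pi : ℂ) / 3) by push_cast; ring,
    norm_mul, Complex.norm_real, Real.norm_of_nonneg (by positivity)]
  refine (mul_le_mul_of_nonneg_left hJ (by positivity)).trans_eq ?_
  field_simp

/-- Asymptotics of `∫ e^{−(i/(2ε³))(z³/3 + z)} (z+i)^{−4}(z−i)^{−2} dz` as `ε → 0⁺`:
it equals `−(√(2π)/12) ε^{−9/2} e^{−1/(3ε³)} + O(ε^{−3} e^{−1/(3ε³)})`. -/
theorem airy_type_asymptotics' :
    ∃ C > (0 : ℝ), ∃ ε₁ > (0 : ℝ), ∀ ε : ℝ, 0 < ε → ε < ε₁ →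
      ‖(∫ z : ℝ,
            Complex.exp (-(Complex.I / (2 * (ε : ℂ) ^ 3)) * ((z : ℂ) ^ 3 / 3 + (z : ℂ))) *
              ((z : ℂ) + Complex.I) ^ (-4 : ℤ) * ((z : ℂ) - Complex.I) ^ (-2 : ℤ))
          + (((Real.sqrt (2 * Real.pi) / 12) * ε ^ (-(9 : ℝ) / 2) *
              Real.exp (-1 / (3 * ε ^ 3)) : ℝ) : ℂ)‖
        ≤ C * ε ^ (-(3 : ℝ)) * Real.exp (-1 / (3 * ε ^ 3)) := by
  refine ⟨(∫ u : ℝ, 2 * Real.exp 1 * Real.exp (-(1 / 2) * u ^ 2)) / 2, ?_, 1 / 2, by norm_num, ?_⟩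
  · rw [integral_const_mul, integral_gaussian]
    positivity
  intro ε hε hε1
  have hs : 0 < ε ^ (3 / 2 : ℝ) := Real.rpow_pos_of_pos hε _
  have hs2 : (ε ^ (3 / 2 : ℝ)) ^ 2 = ε ^ 3 := by
    rw [← Real.rpow_natCast, ← Real.rpow_mul hε.le, ← Real.rpow_natCast]
    norm_num
  have hs3 : ε ^ (-(9 : ℝ) / 2) = ((ε ^ (3 / 2 : ℝ)) ^ 3)⁻¹ := by
    rw [← Real.rpow_natCast, ← Real.rpow_mul hε.le, ← Real.rpow_neg hε.le]
    norm_num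
  have hsqrt2 : Real.sqrt 2 ^ 2 = 2 := Real.sq_sqrt (by norm_num)
  have hm2 : (Real.sqrt 2 * ε ^ (3 / 2 : ℝ)) ^ 2 = 2 * ε ^ 3 := by rw [mul_pow, hs2, hsqrt2]
  have hm : 0 < Real.sqrt 2 * ε ^ (3 / 2 : ℝ) := by positivity
  have hmle : Real.sqrt 2 * ε ^ (3 / 2 : ℝ) ≤ 1 / 2 := by
    refine le_of_sq_le_sq ?_ (by norm_num)
    rw [hm2]
    have : ε ^ 3 ≤ (1 / 2) ^ 3 := by gcongr
    linarith
  have h := norm_integral_airyIntegrand_add_le hm hmle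
  have hmC : ((Real.sqrt 2 * ε ^ (3 / 2 : ℝ) : ℝ) : ℂ) ^ 2 = 2 * (ε : ℂ) ^ 3 := by
    exact_mod_cast hm2
  have hexp : -2 / (3 * (2 * ε ^ 3)) = -1 / (3 * ε ^ 3) := by
    field_simp
  have hcoef : Real.sqrt Real.pi / 3 * ((Real.sqrt 2 * ε ^ (3 / 2 : ℝ)) ^ 3)⁻¹ =
      Real.sqrt (2 * Real.pi) / 12 * ε ^ (-(9 : ℝ) / 2) := by
    rw [hs3, Real.sqrt_mul (by norm_num)]
    field_simp
    linear_combination (-3 * Real.sqrt 2 ^ 2 - 6) * hsqrt2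
  have hpow : ε ^ (-(3 : ℝ)) = (ε ^ 3)⁻¹ := by
    rw [Real.rpow_neg hε.le]
    norm_cast
  simp only [airyIntegrand, hmC] at h
  rw [hm2, hexp, hcoef] at h
  rw [hpow]
  refine h.trans_eq ?_
  ring
end
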